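/- arXiv:1210.2325 — 2 statements merged into one kernel-verified Lean document; each statement's English description precedes it below -/
import Mathlib

section
/- Let d ≥ 1, let p ∈ ℝ^d, and let g : ℝ^d × ℝ → ℝ^d × ℝ, written g(x,y) = (g_x(x,y), g_y(x,y)), be C^∞ on U ∩ (ℝ^d × [0,∞)) for some open neighborhood U of (p,0). Assume g_y(x,0) = 0 for all x with (x,0) ∈ U, that g maps U ∩ (ℝ^d × [0,∞)) into ℝ^d × [0,∞), and that ∂g_y/∂y(p,0) > 0. Define Φ²(x,y) = (x, φ(φ(y))) for y > 0 and Φ²(x,0) = (x,0), where φ(y) = exp(−1/y), with inverse (x,s) ↦ (x, ψ(ψ(s))) where ψ(s) = −1/log(s). Then the map G = (Φ²)⁻¹ ∘ g ∘ Φ² (extended to the boundary by (x,0) ↦ (g_x(x,0), 0)) is C^∞ within ℝ^d × [0,∞) at (p,0), and for every natural number k its k-th iterated derivative within ℝ^d × [0,∞) at (p,0) equals the k-th iterated derivative at (p,0) of the map (x,y) ↦ (g_x(x,0), y). -/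
open Set Filter Topology

universe u

/-- Differentiation under the integral sign over `[0, 1]`, within a convex set. -/
theorem Convex.hasFDerivWithinAt_intervalIntegral
    {E V : Type*} [NormedAddCommGroup E] [NormedSpace ℝ E]
    [NormedAddCommGroup V] [NormedSpace ℝ V] [CompleteSpace V]
    {f : E → ℝ → V} {f' : E → ℝ → E →L[ℝ] V} {s : Set E} (hs : Convex ℝ s)
    (hf : ContinuousOn f.uncurry (s ×ˢ Icc (0 : ℝ) 1))
    (hf' : ContinuousOn f'.uncurry (s ×ˢ Icc (0 : ℝ) 1))
    (hderiv : ∀ x ∈ s, ∀ t ∈ Icc (0 : ℝ) 1, HasFDerivWithinAt (fun x => f x t) (f' x t) s x)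
    {x₀ : E} (hx₀ : x₀ ∈ s) :
    HasFDerivWithinAt (fun x => ∫ t in (0 : ℝ)..1, f x t) (∫ t in (0 : ℝ)..1, f' x₀ t) s x₀ := by
  have hint : ∀ x ∈ s, IntervalIntegrable (f x) MeasureTheory.volume 0 1 := fun x hx => by
    refine ContinuousOn.intervalIntegrable ?_
    rw [uIcc_of_le zero_le_one]
    exact hf.comp (f := fun t => (x, t)) (by fun_prop) (fun t ht => ⟨hx, ht⟩)
  have hint' : IntervalIntegrable (f' x₀) MeasureTheory.volume 0 1 := by
    refine ContinuousOn.intervalIntegrable ?_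
    rw [uIcc_of_le zero_le_one]
    exact hf'.comp (f := fun t => (x₀, t)) (by fun_prop) (fun t ht => ⟨hx₀, ht⟩)
  rw [hasFDerivWithinAt_iff_isLittleO, Asymptotics.isLittleO_iff]
  intro c hc
  obtain ⟨v, hv, hvc⟩ := isCompact_Icc.mem_uniformity_of_prod hf' hx₀
    (Metric.dist_mem_uniformity hc)
  obtain ⟨ε, hε, hball⟩ := Metric.mem_nhdsWithin_iff.1 hv
  filter_upwards [inter_mem_nhdsWithin s (Metric.ball_mem_nhds x₀ hε)] with x hx
  have hbound : ∀ t ∈ Icc (0 : ℝ) 1, ‖f x t - f x₀ t - f' x₀ t (x - x₀)‖ ≤ c * ‖x - x₀‖ := by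
    intro t ht
    refine (hs.inter (convex_ball x₀ ε)).norm_image_sub_le_of_norm_hasFDerivWithin_le'
      (f := fun x => f x t) (f' := fun x => f' x t)
      (fun y hy => (hderiv y hy.1 t ht).mono inter_subset_left) (fun y hy => ?_)
      ⟨hx₀, Metric.mem_ball_self hε⟩ hx
    have := hvc y (hball ⟨hy.2, hy.1⟩) t ht
    rw [← dist_eq_norm]
    exact le_of_lt this
  have happ : (∫ t in (0 : ℝ)..1, f' x₀ t) (x - x₀) = ∫ t in (0 : ℝ)..1, f' x₀ t (x - x₀) :=
    ContinuousLinearMap.intervalIntegral_apply hint' _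
  have hint'' : IntervalIntegrable (fun t => f' x₀ t (x - x₀)) MeasureTheory.volume 0 1 :=
    intervalIntegrable_iff.2 <|
      (ContinuousLinearMap.apply ℝ V (x - x₀)).integrable_comp (intervalIntegrable_iff.1 hint')
  rw [happ, ← intervalIntegral.integral_sub (hint x hx.1) (hint x₀ hx₀),
    ← intervalIntegral.integral_sub ((hint x hx.1).sub (hint x₀ hx₀)) hint'']
  refine (intervalIntegral.norm_integral_le_of_norm_le_const (C := c * ‖x - x₀‖) ?_).trans
    (by simp)
  intro t ht
  rw [uIoc_of_le zero_le_one] at ht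
  exact hbound t (Ioc_subset_Icc_self ht)

/-- The integral over `[0, 1]` of a smooth family of functions on a convex set is smooth. -/
theorem Convex.contDiffOn_intervalIntegral {E V : Type u}
    [NormedAddCommGroup E] [NormedSpace ℝ E]
    [NormedAddCommGroup V] [NormedSpace ℝ V] [CompleteSpace V] {s : Set E}
    (hs : Convex ℝ s) (hu : UniqueDiffOn ℝ s) {f : E × ℝ → V}
    (hf : ContDiffOn ℝ (⊤ : ℕ∞) f (s ×ˢ Icc (0 : ℝ) 1)) :
    ContDiffOn ℝ (⊤ : ℕ∞) (fun x => ∫ t in (0 : ℝ)..1, f (x, t)) s := by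
  have hprod : UniqueDiffOn ℝ (s ×ˢ Icc (0 : ℝ) 1) := hu.prod (uniqueDiffOn_Icc zero_lt_one)
  have key : ∀ {V : Type u} [NormedAddCommGroup V] [NormedSpace ℝ V] [CompleteSpace V]
      {f : E × ℝ → V}, ContDiffOn ℝ (⊤ : ℕ∞) f (s ×ˢ Icc (0 : ℝ) 1) →
      ∃ f' : E × ℝ → E →L[ℝ] V, ContDiffOn ℝ (⊤ : ℕ∞) f' (s ×ˢ Icc (0 : ℝ) 1) ∧
        ∀ x ∈ s, HasFDerivWithinAt (fun x => ∫ t in (0 : ℝ)..1, f (x, t))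
          (∫ t in (0 : ℝ)..1, f' (x, t)) s x := by
    intro V _ _ _ f hf
    have hf' : ContDiffOn ℝ (⊤ : ℕ∞) (fun q => (fderivWithin ℝ f (s ×ˢ Icc (0 : ℝ) 1) q).comp
        (ContinuousLinearMap.inl ℝ E ℝ)) (s ×ˢ Icc (0 : ℝ) 1) :=
      (hf.fderivWithin hprod (by simp)).clm_comp contDiffOn_const
    refine ⟨_, hf', fun x hx => ?_⟩
    refine hs.hasFDerivWithinAt_intervalIntegral (f := fun x t => f (x, t))
      (f' := fun x t => (fderivWithin ℝ f (s ×ˢ Icc (0 : ℝ) 1) (x, t)).comp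
        (ContinuousLinearMap.inl ℝ E ℝ)) hf.continuousOn hf'.continuousOn
      (fun y hy t ht => ?_) hx
    have h1 := (hf.differentiableOn (by simp) (y, t) ⟨hy, ht⟩).hasFDerivWithinAt
    have hm : MapsTo (fun z => (z, t)) s (s ×ˢ Icc (0 : ℝ) 1) := fun z hz => ⟨hz, ht⟩
    exact h1.comp y (hasFDerivAt_prodMk_left y t).hasFDerivWithinAt hm
  rw [contDiffOn_infty]
  intro n
  induction n generalizing V with
  | zero =>
    obtain ⟨f', -, h⟩ := key hf
    exact contDiffOn_zero.2 fun x hx => (h x hx).continuousWithinAt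
  | succ n ih =>
    obtain ⟨f', hf', h⟩ := key hf
    exact (contDiffOn_succ_iff_hasFDerivWithinAt_of_uniqueDiffOn hu).2
      ⟨by simp, _, ih hf', h⟩

/-- Hadamard's lemma in the last variable, within a convex set. -/
theorem Convex.exists_contDiffOn_eq_add_smul {F V : Type u}
    [NormedAddCommGroup F] [NormedSpace ℝ F]
    [NormedAddCommGroup V] [NormedSpace ℝ V] [CompleteSpace V] {s : Set (F × ℝ)}
    (hs : Convex ℝ s) (hu : UniqueDiffOn ℝ s)
    (hcyl : ∀ q ∈ s, ∀ t ∈ Icc (0 : ℝ) 1, (q.1, t * q.2) ∈ s) {f : F × ℝ → V}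
    (hf : ContDiffOn ℝ (⊤ : ℕ∞) f s) :
    ∃ h : F × ℝ → V, ContDiffOn ℝ (⊤ : ℕ∞) h s ∧
      ∀ q ∈ s, f q = f (q.1, 0) + q.2 • h q := by
  have hmaps : MapsTo (fun z : (F × ℝ) × ℝ => (z.1.1, z.2 * z.1.2)) (s ×ˢ Icc (0 : ℝ) 1) s :=
    fun z hz => hcyl z.1 hz.1 z.2 hz.2
  have hsmooth : ContDiffOn ℝ (⊤ : ℕ∞)
      (fun z : (F × ℝ) × ℝ => fderivWithin ℝ f s (z.1.1, z.2 * z.1.2) (0, 1))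
      (s ×ˢ Icc (0 : ℝ) 1) :=
    ((hf.fderivWithin hu (m := (⊤ : ℕ∞)) (by simp)).comp (by fun_prop) hmaps).clm_apply
      contDiffOn_const
  refine ⟨_, hs.contDiffOn_intervalIntegral hu hsmooth, fun q hq => ?_⟩
  have hd : ∀ t ∈ Icc (0 : ℝ) 1, HasDerivWithinAt (fun t => f (q.1, t * q.2))
      (q.2 • fderivWithin ℝ f s (q.1, t * q.2) (0, 1)) (Icc 0 1) t := by
    intro t ht
    have h1 := (hf.differentiableOn (by simp) _ (hcyl q hq t ht)).hasFDerivWithinAt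
    have h2 : HasDerivWithinAt (fun t : ℝ => (q.1, t * q.2)) (0, 1 * q.2) (Icc 0 1) t :=
      (hasDerivWithinAt_const ..).prodMk ((hasDerivWithinAt_id ..).mul_const q.2)
    have h3 := h1.comp_hasDerivWithinAt t h2 (fun t ht => hcyl q hq t ht)
    rw [← map_smul]
    simpa [Function.comp_def] using h3
  have hcont : ContinuousOn (fun t => q.2 • fderivWithin ℝ f s (q.1, t * q.2) (0, 1))
      (Icc (0 : ℝ) 1) :=
    (hsmooth.continuousOn.comp (f := fun t => (q, t)) (by fun_prop)
      (fun t ht => ⟨hq, ht⟩)).const_smul q.2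
  have hftc := intervalIntegral.integral_eq_sub_of_hasDerivAt_of_le zero_le_one
    (fun t ht => (hd t ht).continuousWithinAt)
    (fun t ht => (hd t (Ioo_subset_Icc_self ht)).hasDerivAt (Icc_mem_nhds ht.1 ht.2))
    (hcont.intervalIntegrable_of_Icc zero_le_one)
  rw [intervalIntegral.integral_smul] at hftc
  simp only [one_mul, zero_mul, Prod.mk.eta] at hftc
  rw [hftc]
  abel

/-- A smooth function vanishing on a closed half-space has vanishing derivatives of all orders on
the boundary. -/
theorem iteratedFDeriv_eq_zero_of_eqOn_halfSpace {F V : Type*}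
    [NormedAddCommGroup F] [NormedSpace ℝ F] [NormedAddCommGroup V] [NormedSpace ℝ V]
    {f : F × ℝ → V} (hf : ContDiff ℝ (⊤ : ℕ∞) f) (h0 : ∀ q : F × ℝ, q.2 ≤ 0 → f q = 0)
    (x : F) (k : ℕ) : iteratedFDeriv ℝ k f (x, 0) = 0 := by
  have hu : UniqueDiffOn ℝ {q : F × ℝ | q.2 ≤ 0} := by
    have := (uniqueDiffOn_univ (𝕜 := ℝ) (E := F)).prod (uniqueDiffOn_Iic (0 : ℝ))
    rwa [univ_prod] at this
  have hx : (x, (0 : ℝ)) ∈ {q : F × ℝ | q.2 ≤ 0} := le_refl (0 : ℝ)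
  rw [← iteratedFDerivWithin_eq_iteratedFDeriv hu
    (hf.contDiffAt.of_le (mod_cast le_top)) hx,
    iteratedFDerivWithin_congr (f := fun _ => (0 : V)) (s := {q : F × ℝ | q.2 ≤ 0})
      (fun q hq => h0 q hq) hx]
  simp

/-- Multiplying by a function with vanishing jet gives a function with vanishing jet. -/
theorem iteratedFDerivWithin_smul_eq_zero {E V : Type*}
    [NormedAddCommGroup E] [NormedSpace ℝ E] [NormedAddCommGroup V] [NormedSpace ℝ V]
    {s : Set E} (hu : UniqueDiffOn ℝ s) {x : E} (hx : x ∈ s) {c : E → ℝ} {f : E → V}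
    (hc : ContDiff ℝ (⊤ : ℕ∞) c) (hc0 : ∀ k : ℕ, iteratedFDeriv ℝ k c x = 0)
    (hf : ContDiffWithinAt ℝ (⊤ : ℕ∞) f s x) (k : ℕ) :
    iteratedFDerivWithin ℝ k (fun y => c y • f y) s x = 0 := by
  obtain ⟨u, hu_open, hxu, hfu⟩ := hf.contDiffOn' (m := k) (mod_cast le_top) (by simp)
  rw [insert_eq_of_mem hx] at hfu
  have hck : ContDiff ℝ k c := hc.of_le (mod_cast le_top)
  have hle := norm_iteratedFDerivWithin_smul_le hck.contDiffOn hfu (hu.inter hu_open)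
    ⟨hx, hxu⟩ le_rfl
  rw [← iteratedFDerivWithin_inter_open hu_open hxu, ← norm_le_zero_iff]
  refine hle.trans (le_of_eq (Finset.sum_eq_zero fun i _ => ?_))
  rw [iteratedFDerivWithin_eq_iteratedFDeriv (hu.inter hu_open)
    (hc.contDiffAt.of_le (mod_cast le_top)) ⟨hx, hxu⟩, hc0]
  simp

theorem expNegInvGlue_of_pos {y : ℝ} (hy : 0 < y) : expNegInvGlue y = Real.exp (-1 / y) := by
  rw [expNegInvGlue, if_neg hy.not_ge, neg_div, one_div]

theorem neg_one_div_log_neg_one_div_log_expNegInvGlue_mul {y h : ℝ} (hy : 0 < y) (hh : 0 < h)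
    (h1 : 0 < 1 - expNegInvGlue y * Real.log h) :
    -1 / Real.log (-1 / Real.log (expNegInvGlue (expNegInvGlue y) * h)) =
      y / (1 + y * Real.log (1 - expNegInvGlue y * Real.log h)) := by
  have hX := expNegInvGlue.pos_of_pos hy
  have hinner : -1 / Real.log (expNegInvGlue (expNegInvGlue y) * h) =
      expNegInvGlue y / (1 - expNegInvGlue y * Real.log h) := by
    rw [Real.log_mul (expNegInvGlue.pos_of_pos hX).ne' hh.ne', expNegInvGlue_of_pos hX,
      Real.log_exp]
    have : -1 / expNegInvGlue y + Real.log h =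
        -(1 - expNegInvGlue y * Real.log h) / expNegInvGlue y := by
      field_simp
      ring
    rw [this, div_div_eq_mul_div, neg_one_mul, neg_div_neg_eq]
  rw [hinner, Real.log_div hX.ne' h1.ne']
  have hlog : Real.log (expNegInvGlue y) = -1 / y := by rw [expNegInvGlue_of_pos hy, Real.log_exp]
  rw [hlog]
  have : -1 / y - Real.log (1 - expNegInvGlue y * Real.log h) =
      -(1 + y * Real.log (1 - expNegInvGlue y * Real.log h)) / y := by
    field_simp
    ring
  rw [this, div_div_eq_mul_div, neg_one_mul, neg_div_neg_eq]

/-- `log (1 - u)` is `u` times a function smooth near `0`. -/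
theorem exists_contDiffAt_log_one_sub_eq_mul :
    ∃ k : ℝ → ℝ, ContDiffAt ℝ (⊤ : ℕ∞) k 0 ∧ ∀ u, Real.log (1 - u) = u * k u := by
  have ha : AnalyticAt ℝ (fun u : ℝ => Real.log (1 - u)) 0 :=
    (analyticAt_const.sub analyticAt_id).log (by simp)
  obtain ⟨p, hp⟩ := ha
  refine ⟨_, hp.has_fpower_series_dslope_fslope.analyticAt.contDiffAt, fun u => ?_⟩
  have := sub_smul_dslope (fun u : ℝ => Real.log (1 - u)) 0 u
  simpa using this.symm

/-- Claim (2) of the main gluing theorem: the map `G = (Φ²)⁻¹ ∘ g ∘ Φ²` (with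
`Φ²(x,y) = (x, φ(φ y))`, `φ(y) = exp(-1/y)`, inverse `ψ(s) = -1/log s`), extended to the
boundary by `(x,0) ↦ (g_x(x,0), 0)`, is `C^∞` within the closed half-space at `(p,0)` and
"looks to all orders like" the product map `(x,y) ↦ (g_x(x,0), y)` there. -/
theorem stmt2 (d : ℕ) (hd : 1 ≤ d) (p : Fin d → ℝ)
    (g : (Fin d → ℝ) × ℝ → (Fin d → ℝ) × ℝ)
    (U : Set ((Fin d → ℝ) × ℝ)) (hU : IsOpen U) (hpU : (p, (0 : ℝ)) ∈ U)
    (hg : ContDiffOn ℝ (⊤ : ℕ∞) g (U ∩ {q | 0 ≤ q.2}))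
    (hbd : ∀ x : Fin d → ℝ, (x, (0 : ℝ)) ∈ U → (g (x, 0)).2 = 0)
    (hmaps : Set.MapsTo g (U ∩ {q | 0 ≤ q.2}) {q | 0 ≤ q.2})
    (hderiv : 0 < derivWithin (fun y : ℝ => (g (p, y)).2) (Set.Ici 0) 0)
    (φ ψ : ℝ → ℝ) (hφ : ∀ y, φ y = Real.exp (-1 / y)) (hψ : ∀ s, ψ s = -1 / Real.log s)
    (G : (Fin d → ℝ) × ℝ → (Fin d → ℝ) × ℝ)
    (hG : ∀ q : (Fin d → ℝ) × ℝ,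
      G q = if 0 < q.2 then
              ((g (q.1, φ (φ q.2))).1, ψ (ψ ((g (q.1, φ (φ q.2))).2)))
            else ((g (q.1, 0)).1, 0)) :
    ContDiffWithinAt ℝ (⊤ : ℕ∞) G {q | 0 ≤ q.2} (p, 0) ∧
    ∀ k : ℕ,
      iteratedFDerivWithin ℝ k G {q | 0 ≤ q.2} (p, 0) =
        iteratedFDerivWithin ℝ k (fun q : (Fin d → ℝ) × ℝ => ((g (q.1, 0)).1, q.2))
          {q | 0 ≤ q.2} (p, 0) := by
  set H : Set ((Fin d → ℝ) × ℝ) := {q | 0 ≤ q.2}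
  have hHconv : Convex ℝ H := by
    have := (convex_univ (𝕜 := ℝ) (E := Fin d → ℝ)).prod (convex_Ici (0 : ℝ))
    rwa [univ_prod] at this
  have hHu : UniqueDiffOn ℝ H := by
    have := (uniqueDiffOn_univ (𝕜 := ℝ) (E := Fin d → ℝ)).prod (uniqueDiffOn_Ici (0 : ℝ))
    rwa [univ_prod] at this
  have hpH : (p, (0 : ℝ)) ∈ H := le_refl (0 : ℝ)
  obtain ⟨r, hr, hrU⟩ := Metric.isOpen_iff.1 hU _ hpU
  set S := H ∩ Metric.ball (p, (0 : ℝ)) r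
  have hSu : UniqueDiffOn ℝ S := hHu.inter Metric.isOpen_ball
  have hpS : (p, (0 : ℝ)) ∈ S := ⟨hpH, Metric.mem_ball_self hr⟩
  have hSnhds : S ∈ 𝓝[H] (p, (0 : ℝ)) := inter_mem_nhdsWithin _ (Metric.ball_mem_nhds _ hr)
  have hcyl : ∀ q ∈ S, ∀ t ∈ Icc (0 : ℝ) 1, (q.1, t * q.2) ∈ S := by
    intro q hq t ht
    refine ⟨mul_nonneg ht.1 hq.1, ?_⟩
    have h1 := hq.2
    rw [Metric.mem_ball, Prod.dist_eq, max_lt_iff] at h1 ⊢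
    refine ⟨h1.1, lt_of_le_of_lt ?_ h1.2⟩
    simp only [Real.dist_eq, sub_zero, abs_mul, abs_of_nonneg ht.1]
    exact mul_le_of_le_one_left (abs_nonneg _) ht.2
  have hgS : ContDiffOn ℝ (⊤ : ℕ∞) g S := hg.mono fun q hq => ⟨hrU hq.2, hq.1⟩
  obtain ⟨h, hh, hgh⟩ := (hHconv.inter (convex_ball _ _)).exists_contDiffOn_eq_add_smul
    hSu hcyl hgS
  have hhH : ContDiffWithinAt ℝ (⊤ : ℕ∞) h H (p, 0) :=
    (hh _ hpS).mono_of_mem_nhdsWithin hSnhds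
  have hS0 : ∀ q ∈ S, (q.1, (0 : ℝ)) ∈ S := fun q hq => by
    simpa using hcyl q hq 0 (by simp)
  have hpos : 0 < (h (p, 0)).2 := by
    have hpt : Tendsto (fun y : ℝ => (p, y)) (𝓝[Ici 0] 0) (𝓝[H] (p, 0)) :=
      (Continuous.continuousWithinAt (by fun_prop)).tendsto_nhdsWithin fun y hy => hy
    have hd1 : DifferentiableWithinAt ℝ (fun y : ℝ => (h (p, y)).2) (Ici 0) 0 :=
      ((hhH.differentiableWithinAt (by simp)).comp (f := fun y : ℝ => (p, y)) 0
        (by fun_prop) (fun y hy => hy)).snd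
    have hd2 := (hasDerivWithinAt_id (0 : ℝ) (Ici 0)).mul hd1.hasDerivWithinAt
    have hd3 : HasDerivWithinAt (fun y : ℝ => (g (p, y)).2) (h (p, 0)).2 (Ici 0) 0 := by
      refine (hd2.congr_of_eventuallyEq ?_ ?_).congr_deriv (by simp)
      · filter_upwards [hpt hSnhds] with y hy
        rw [hgh _ hy]
        simp [hbd p hpU]
      · simp [hbd p hpU]
    rwa [hd3.derivWithin (uniqueDiffOn_Ici (0 : ℝ) 0 self_mem_Ici)] at hderiv
  set X := expNegInvGlue with hX
  have hXs : ContDiff ℝ (⊤ : ℕ∞) X := expNegInvGlue.contDiff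
  have hX0 : X 0 = 0 := expNegInvGlue.zero
  have hXnonneg : ∀ y, 0 ≤ X y := expNegInvGlue.nonneg
  have hc1 : ContDiff ℝ (⊤ : ℕ∞) (fun q : (Fin d → ℝ) × ℝ => X q.2) := hXs.comp contDiff_snd
  have hc2 : ContDiff ℝ (⊤ : ℕ∞) (fun q : (Fin d → ℝ) × ℝ => X (X q.2)) := hXs.comp hc1
  have he : ContDiffWithinAt ℝ (⊤ : ℕ∞)
      (fun q : (Fin d → ℝ) × ℝ => (q.1, X (X q.2))) H (p, 0) :=
    (contDiff_fst.prodMk hc2).contDiffWithinAt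
  have heH : MapsTo (fun q : (Fin d → ℝ) × ℝ => (q.1, X (X q.2))) H H :=
    fun q _ => hXnonneg _
  have hep : ((p, X (X 0)) : (Fin d → ℝ) × ℝ) = (p, 0) := by rw [hX0, hX0]
  have hhe : ContDiffWithinAt ℝ (⊤ : ℕ∞) (fun q => h (q.1, X (X q.2))) H (p, 0) :=
    ContDiffWithinAt.comp (g := h) _ (by simpa only [hep] using hhH) he heH
  have hpos' : 0 < (h ((p, (0 : ℝ)).1, X (X (p, (0 : ℝ)).2))).2 := by simpa only [hep] using hpos
  set L : (Fin d → ℝ) × ℝ → ℝ := fun q => Real.log (h (q.1, X (X q.2))).2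
  have hLs : ContDiffWithinAt ℝ (⊤ : ℕ∞) L H (p, 0) := hhe.snd.log hpos'.ne'
  have hXL : ContDiffWithinAt ℝ (⊤ : ℕ∞) (fun q => X q.2 * L q) H (p, 0) :=
    hc1.contDiffWithinAt.mul hLs
  obtain ⟨k, hk, hlogk⟩ := exists_contDiffAt_log_one_sub_eq_mul
  have hkXL : ContDiffWithinAt ℝ (⊤ : ℕ∞) (fun q => k (X q.2 * L q)) H (p, 0) :=
    ContDiffAt.comp_contDiffWithinAt (g := k) (p, 0) (by simpa [hX0] using hk) hXL
  have hden : ContDiffWithinAt ℝ (⊤ : ℕ∞)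
      (fun q => 1 + q.2 * (X q.2 * L q * k (X q.2 * L q))) H (p, 0) :=
    contDiffWithinAt_const.add (contDiffWithinAt_snd.mul (hXL.mul hkXL))
  set R₁ : (Fin d → ℝ) × ℝ → (Fin d → ℝ) × ℝ := fun q => ((h (q.1, X (X q.2))).1, 0) with hR₁
  set R₂ : (Fin d → ℝ) × ℝ → (Fin d → ℝ) × ℝ := fun q =>
    (0, -(q.2 ^ 2 * (L q * k (X q.2 * L q))) /
      (1 + q.2 * (X q.2 * L q * k (X q.2 * L q)))) with hR₂
  have hR₁s : ContDiffWithinAt ℝ (⊤ : ℕ∞) R₁ H (p, 0) := hhe.fst.prodMk contDiffWithinAt_const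
  have hR₂s : ContDiffWithinAt ℝ (⊤ : ℕ∞) R₂ H (p, 0) :=
    contDiffWithinAt_const.prodMk
      (((contDiffWithinAt_snd.pow 2).mul (hLs.mul hkXL)).neg.div hden (by simp))
  set T : (Fin d → ℝ) × ℝ → (Fin d → ℝ) × ℝ := fun q => ((g (q.1, 0)).1, q.2) with hT
  have hgH : ContDiffWithinAt ℝ (⊤ : ℕ∞) g H (p, 0) :=
    (hgS _ hpS).mono_of_mem_nhdsWithin hSnhds
  have hTs : ContDiffWithinAt ℝ (⊤ : ℕ∞) T H (p, 0) := by
    refine ContDiffWithinAt.prodMk (ContDiffWithinAt.fst ?_) contDiffWithinAt_snd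
    exact ContDiffWithinAt.comp (g := g) (f := fun q : (Fin d → ℝ) × ℝ => (q.1, (0 : ℝ))) (p, 0)
      hgH (contDiffWithinAt_fst.prodMk contDiffWithinAt_const) fun q _ => le_refl (0 : ℝ)
  have hcR₁ : ContDiffWithinAt ℝ (⊤ : ℕ∞) (fun q => X (X q.2) • R₁ q) H (p, 0) :=
    hc2.contDiffWithinAt.smul hR₁s
  have hcR₂ : ContDiffWithinAt ℝ (⊤ : ℕ∞) (fun q => X q.2 • R₂ q) H (p, 0) :=
    hc1.contDiffWithinAt.smul hR₂s
  have hGeq : G =ᶠ[𝓝[H] (p, 0)]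
      T + ((fun q => X (X q.2) • R₁ q) + fun q => X q.2 • R₂ q) := by
    have ev1 := he.continuousWithinAt.tendsto_nhdsWithin heH
    rw [hep] at ev1
    have ev2 := hhe.snd.continuousWithinAt.eventually_const_lt hpos'
    have ev3 : ∀ᶠ q in 𝓝[H] (p, (0 : ℝ)), X q.2 * L q < 1 :=
      hXL.continuousWithinAt.eventually_lt_const (by simp [hX0])
    have ev4 := hden.continuousWithinAt.eventually_const_lt (u := 0) (by simp)
    filter_upwards [ev1 hSnhds, hSnhds, ev2, ev3, ev4] with q h1 h1' h2 h3 h4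
    rw [hG]
    split_ifs with hq
    · have hφφ : φ (φ q.2) = X (X q.2) := by
        rw [hφ q.2, ← expNegInvGlue_of_pos hq, hφ,
          ← expNegInvGlue_of_pos (expNegInvGlue.pos_of_pos hq)]
      have hg1 := hgh _ h1
      have hgy : (g (q.1, X (X q.2))).2 = X (X q.2) * (h (q.1, X (X q.2))).2 := by
        rw [hg1]
        simp [hbd q.1 (hrU (hS0 q h1').2)]
      have hW := hlogk (X q.2 * L q)
      have hfin := neg_one_div_log_neg_one_div_log_expNegInvGlue_mul hq h2 (sub_pos.2 h3)
      rw [hφφ, hgy, hψ (_ * _), hψ, hfin]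
      refine Prod.ext ?_ ?_
      · rw [hg1]
        simp [hT, hR₁, hR₂]
      · change q.2 / (1 + q.2 * Real.log (1 - X q.2 * L q)) = _
        rw [hW]
        simp only [hT, hR₁, hR₂, Pi.add_apply, Prod.snd_add, Prod.smul_snd, smul_eq_mul, mul_zero,
          zero_add]
        rw [mul_div_assoc', div_eq_iff h4.ne', add_mul, div_mul_cancel₀ _ h4.ne']
        ring
    · have hq0 : q.2 = 0 := le_antisymm (not_lt.1 hq) h1'.1
      simp [hT, hq0, hX0]
  have hGp : G (p, 0) = (T + ((fun q => X (X q.2) • R₁ q) + fun q => X q.2 • R₂ q)) (p, 0) :=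
    hGeq.self_of_nhdsWithin hpH
  refine ⟨(hTs.add (hcR₁.add hcR₂)).congr_of_eventuallyEq hGeq hGp, fun n => ?_⟩
  have hn : ((n : ℕ∞) : WithTop ℕ∞) ≤ ((⊤ : ℕ∞) : WithTop ℕ∞) := mod_cast le_top
  have hsum : ContDiffWithinAt ℝ n ((fun q => X (X q.2) • R₁ q) + fun q => X q.2 • R₂ q) H (p, 0) :=
    (hcR₁.add hcR₂).of_le hn
  rw [hGeq.iteratedFDerivWithin_eq hGp,
    iteratedFDerivWithin_add_apply (hTs.of_le hn) hsum hHu hpH,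
    iteratedFDerivWithin_add_apply (hcR₁.of_le hn) (hcR₂.of_le hn) hHu hpH,
    iteratedFDerivWithin_smul_eq_zero hHu hpH hc2
      (iteratedFDeriv_eq_zero_of_eqOn_halfSpace hc2
        (fun q hq => by simp [hX, expNegInvGlue.zero_of_nonpos hq, expNegInvGlue.zero]) p) hR₁s,
    iteratedFDerivWithin_smul_eq_zero hHu hpH hc1
      (iteratedFDeriv_eq_zero_of_eqOn_halfSpace hc1
        (fun q hq => expNegInvGlue.zero_of_nonpos hq) p) hR₂s]
  simp
end

section
/- Let a > 0 and δ > 0, and let u : ℝ → ℝ satisfy (a/2)·t ≤ u(t) ≤ 2a·t for all t ∈ (0, δ). Define φ(y) = exp(−1/y) and ψ(s) = −1/log(s). Then for every natural number k, the quotient (ψ(ψ(u(φ(φ(y))))) − y) / y^k tends to 0 as y tends to 0 from the right. -/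
open Filter Topology in
theorem tendsto_exp_neg_one_div_div_pow (k : ℕ) :
    Tendsto (fun y : ℝ => Real.exp (-1 / y) / y ^ k) (𝓝[>] 0) (𝓝 0) := by
  refine ((Real.tendsto_pow_mul_exp_neg_atTop_nhds_zero k).comp tendsto_inv_nhdsGT_zero).congr ?_
  intro y
  simp only [Function.comp_apply, inv_pow, neg_div, one_div]
  rw [div_eq_inv_mul]

open Filter Topology in
theorem tendsto_exp_neg_one_div_nhdsGT :
    Tendsto (fun y : ℝ => Real.exp (-1 / y)) (𝓝[>] 0) (𝓝[>] 0) :=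
  tendsto_nhdsWithin_iff.2
    ⟨by simpa using tendsto_exp_neg_one_div_div_pow 0, .of_forall fun _ => Real.exp_pos _⟩

theorem abs_log_one_sub_le {x : ℝ} (hx : |x| ≤ 1 / 2) : |Real.log (1 - x)| ≤ 2 * |x| := by
  obtain ⟨h1, h2⟩ := abs_le.1 hx
  have hpos : 0 < 1 - x := by linarith
  have hupper := Real.log_le_sub_one_of_pos hpos
  have hlower := Real.one_sub_inv_le_log_of_pos hpos
  have hinv : 1 - (1 - x)⁻¹ = -(x / (1 - x)) := by field_simp; ring
  have hquot : |x / (1 - x)| ≤ 2 * |x| := by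
    rw [abs_div, abs_of_pos hpos, div_le_iff₀ hpos]
    nlinarith [abs_nonneg x]
  have := le_abs_self (x / (1 - x))
  refine abs_le.2 ⟨by linarith, ?_⟩
  linarith [neg_abs_le x, abs_nonneg x]

/-- If `l` is a small perturbation, then inverting `1 / y + l` recovers `y` up to `2 * |l|`. -/
theorem abs_one_div_one_div_add_sub_le {y l : ℝ} (hy : 0 < y) (hy1 : y ≤ 1) (hl : |l| ≤ 1 / 2) :
    |1 / (1 / y + l) - y| ≤ 2 * |l| := by
  have hyl : |y * l| ≤ 1 / 2 := by
    rw [abs_mul, abs_of_pos hy]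
    nlinarith [abs_nonneg l]
  have hden : 1 / 2 ≤ 1 + y * l := by linarith [(abs_le.1 hyl).1]
  have hpos : 0 < 1 + y * l := by linarith
  have hsum : 1 / y + l = (1 + y * l) / y := by field_simp
  have heq : 1 / (1 / y + l) - y = -(y ^ 2 * l) / (1 + y * l) := by
    rw [hsum, one_div_div]
    field_simp
    ring
  have hsq : y ^ 2 ≤ 1 := pow_le_one₀ hy.le hy1
  rw [heq, abs_div, abs_neg, abs_mul, abs_of_pos hpos, abs_of_nonneg (sq_nonneg y),
    div_le_iff₀ hpos]
  nlinarith [abs_nonneg l]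

theorem abs_log_le_of_mem_Icc {p q v : ℝ} (hp : 0 < p) (hpv : p ≤ v) (hvq : v ≤ q) :
    |Real.log v| ≤ |Real.log p| + |Real.log q| := by
  have h1 := Real.log_le_log hp hpv
  have h2 := Real.log_le_log (hp.trans_le hpv) hvq
  refine abs_le.2 ⟨?_, ?_⟩
  · linarith [neg_abs_le (Real.log p), abs_nonneg (Real.log q)]
  · linarith [le_abs_self (Real.log q), abs_nonneg (Real.log p)]

/-- Conjugating multiplication by `v` twice by `exp (-1 / y)` moves `y` by at most a multiple of
`exp (-1 / y)`. -/
theorem abs_conj_mul_sub_le {y v C : ℝ} (hy : 0 < y) (hy1 : y ≤ 1) (hv : 0 < v)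
    (hvC : |Real.log v| ≤ C) (hC : C * Real.exp (-1 / y) ≤ 1 / 4) :
    |-1 / Real.log (-1 / Real.log (v * Real.exp (-1 / Real.exp (-1 / y)))) - y| ≤
      4 * C * Real.exp (-1 / y) := by
  have hlogs : Real.log (Real.exp (-1 / y)) = -1 / y := Real.log_exp _
  have hs : 0 < Real.exp (-1 / y) := Real.exp_pos _
  generalize Real.exp (-1 / y) = s at *
  have hcs : |Real.log v * s| ≤ C * s := by
    rw [abs_mul, abs_of_pos hs]
    gcongr
  have hpos : 0 < 1 - Real.log v * s := by linarith [(abs_le.1 hcs).2]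
  have hinner : -1 / Real.log (v * Real.exp (-1 / s)) = s / (1 - Real.log v * s) := by
    rw [Real.log_mul hv.ne' (Real.exp_ne_zero _), Real.log_exp]
    have : Real.log v + -1 / s = -((1 - Real.log v * s) / s) := by field_simp; ring
    rw [this, neg_div_neg_eq, one_div_div]
  have hl : |Real.log (1 - Real.log v * s)| ≤ 2 * |Real.log v * s| :=
    abs_log_one_sub_le (by linarith)
  have houter : -1 / Real.log (s / (1 - Real.log v * s)) =
      1 / (1 / y + Real.log (1 - Real.log v * s)) := by
    rw [Real.log_div hs.ne' hpos.ne', hlogs, ← neg_div_neg_eq]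
    congr 1 <;> ring
  rw [hinner, houter]
  linarith [abs_one_div_one_div_add_sub_le hy hy1 (hl.trans (by linarith))]

/-- The sandwich argument in Claim (2) of the main gluing theorem: if
`(a/2)·t ≤ u(t) ≤ 2a·t` on `(0, δ)` with `a > 0`, then with `φ(y) = exp(-1/y)` and
`ψ(s) = -1/log s`, the quantity `ψ(ψ(u(φ(φ y)))) - y` vanishes faster than any power of `y`
as `y → 0⁺`. -/
theorem stmt6 (a δ : ℝ) (ha : 0 < a) (hδ : 0 < δ) (u : ℝ → ℝ)
    (hu : ∀ t ∈ Set.Ioo 0 δ, a / 2 * t ≤ u t ∧ u t ≤ 2 * a * t)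
    (φ ψ : ℝ → ℝ) (hφ : ∀ y, φ y = Real.exp (-1 / y)) (hψ : ∀ s, ψ s = -1 / Real.log s) :
    ∀ k : ℕ,
      Filter.Tendsto (fun y : ℝ => (ψ (ψ (u (φ (φ y)))) - y) / y ^ k)
        (nhdsWithin 0 (Set.Ioi 0)) (nhds 0) := by
  intro k
  obtain ⟨C, hC⟩ : ∃ C, C = |Real.log (a / 2)| + |Real.log (2 * a)| := ⟨_, rfl⟩
  have hs := tendsto_exp_neg_one_div_nhdsGT
  have ht : ∀ᶠ y : ℝ in nhdsWithin 0 (Set.Ioi 0),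
      Real.exp (-1 / Real.exp (-1 / y)) ∈ Set.Ioo 0 δ :=
    (hs.comp hs).eventually (Ioo_mem_nhdsGT hδ)
  have hCs : ∀ᶠ y : ℝ in nhdsWithin 0 (Set.Ioi 0), C * Real.exp (-1 / y) < 1 / 4 := by
    have := (hs.mono_right nhdsWithin_le_nhds).const_mul C
    rw [mul_zero] at this
    exact this.eventually_lt_const (by norm_num)
  refine squeeze_zero_norm' (a := fun y => 4 * C * (Real.exp (-1 / y) / y ^ k)) ?_
    (by simpa using (tendsto_exp_neg_one_div_div_pow k).const_mul (4 * C))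
  filter_upwards [ht, hCs, Ioo_mem_nhdsGT (zero_lt_one' ℝ)] with y hty hCy hy
  obtain ⟨hlow, hupp⟩ := hu _ hty
  have hlow' := (le_div_iff₀ hty.1).2 hlow
  have hupp' := (div_le_iff₀ hty.1).2 hupp
  have hbound := abs_conj_mul_sub_le hy.1 hy.2.le ((half_pos ha).trans_le hlow')
    (hC ▸ abs_log_le_of_mem_Icc (half_pos ha) hlow' hupp') hCy.le
  rw [div_mul_cancel₀ _ hty.1.ne'] at hbound
  have hyk : 0 < y ^ k := pow_pos hy.1 k
  simp only [hφ, hψ]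
  rw [Real.norm_eq_abs, abs_div, abs_of_pos hyk, ← mul_div_assoc]
  gcongr
end
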